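/- arXiv:2012.06198 — 2 statements merged into one kernel-verified Lean document; each statement's English description precedes it below -/
import Mathlib

section
/- Let α and β be finite types and let r : α → β → Prop be a relation. Define a matching of r as a finset S ⊆ α together with an injective function f : α → β such that r a (f a) holds for every a ∈ S, with size |S|, and let M be the maximum size of a matching. Then the number of unmatched elements, |α| − M, equals the maximum over all finsets X ⊆ α of (|X| − |Λ(X)|), where Λ(X) = {b : β | ∃ a ∈ X, r a b}. -/
/-- Deficiency version of Hall's theorem: if `|X| ≤ |Λ(X)| + d` for all `X`, then all but at most
`d` elements of `α` can be matched. -/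
theorem exists_injOn_rel_of_card_le_add {α β : Type*} [Fintype α] [Fintype β]
    (r : α → β → Prop) (d : ℕ) (f₀ : α → β)
    (h : ∀ X : Finset α, X.card ≤ {b : β | ∃ a ∈ X, r a b}.ncard + d) :
    ∃ (S : Finset α) (f : α → β),
      Set.InjOn f S ∧ (∀ a ∈ S, r a (f a)) ∧ Fintype.card α ≤ S.card + d := by
  classical
  let t : α → Finset (β ⊕ Fin d) := fun a => (Finset.univ.filter (r a)).disjSum Finset.univ
  obtain ⟨g, hg, hgt⟩ := (Finset.all_card_le_biUnion_card_iff_exists_injective t).1 fun X => by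
    rcases X.eq_empty_or_nonempty with rfl | ⟨a₀, ha₀⟩
    · simp
    have hX : X.biUnion t =
        (Finset.univ.filter fun b => ∃ a ∈ X, r a b).disjSum Finset.univ := by
      ext (b | i)
      · simp [t]
      · simpa [t] using ⟨a₀, ha₀⟩
    rw [hX, Finset.card_disjSum, Finset.card_univ, Fintype.card_fin]
    simpa [Set.ncard_eq_toFinset_card'] using h X
  refine ⟨Finset.univ.filter fun a => (g a).isLeft,
    fun a => (g a).elim id fun _ => f₀ a, ?_, ?_, ?_⟩
  · intro a ha b hb hab
    obtain ⟨x, hx⟩ := Sum.isLeft_iff.1 (Finset.mem_filter.1 ha).2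
    obtain ⟨y, hy⟩ := Sum.isLeft_iff.1 (Finset.mem_filter.1 hb).2
    simp only [hx, hy, Sum.elim_inl, id] at hab
    exact hg (by rw [hx, hy, hab])
  · intro a ha
    obtain ⟨x, hx⟩ := Sum.isLeft_iff.1 (Finset.mem_filter.1 ha).2
    simpa [hx, t] using hgt a
  · rw [← Finset.card_univ, ← Finset.card_filter_add_card_filter_not fun a => (g a).isLeft]
    gcongr
    calc _ = ((Finset.univ.filter fun a => ¬ (g a).isLeft).image g).card :=
          (Finset.card_image_of_injective _ hg).symm
      _ ≤ ((Finset.univ : Finset (Fin d)).image (Sum.inr : Fin d → β ⊕ Fin d)).card := by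
          refine Finset.card_le_card fun y hy => ?_
          obtain ⟨a, ha, rfl⟩ := Finset.mem_image.1 hy
          obtain ⟨i, hi⟩ := Sum.isRight_iff.1 (by simpa using ha)
          simp [hi]
      _ ≤ d := Finset.card_image_le.trans (by simp)

/-- A map injective on `S` agrees on `S` with a globally injective map, when there is room. -/
theorem exists_injective_eqOn_of_card_le {α β : Type*} [Fintype α] [Fintype β]
    (h : Fintype.card α ≤ Fintype.card β) {S : Finset α} {f : α → β} (hf : Set.InjOn f S) :
    ∃ g : α → β, Function.Injective g ∧ ∀ a ∈ S, g a = f a := by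
  classical
  obtain ⟨T, hST, hT⟩ := Finset.exists_superset_card_eq (s := S.image f) (n := Fintype.card α)
    (Finset.card_image_le.trans (Finset.card_le_univ S)) h
  obtain ⟨e, he⟩ := Finset.exists_equiv_extend_of_card_eq hT.symm hST hf
  exact ⟨fun a => e a, Subtype.val_injective.comp e.injective, he⟩

/-- A matching of `S` bounds the deficiency of every set by the number of unmatched elements. -/
theorem card_add_card_le_of_matching {α β : Type*} [Fintype α] [Finite β]
    {r : α → β → Prop} {S : Finset α} {f : α → β} (hf : Set.InjOn f S)
    (hr : ∀ a ∈ S, r a (f a)) (X : Finset α) :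
    X.card + S.card ≤ {b : β | ∃ a ∈ X, r a b}.ncard + Fintype.card α := by
  classical
  rw [← Finset.card_union_add_card_inter, add_comm]
  refine add_le_add ?_ (Finset.card_le_univ _)
  rw [← Set.ncard_coe_finset]
  refine Set.ncard_le_ncard_of_injOn f (fun a ha => ?_) (hf.mono ?_)
  · obtain ⟨haX, haS⟩ := Finset.mem_inter.1 ha
    exact ⟨a, haX, hr a haS⟩
  · exact_mod_cast Finset.inter_subset_right

/-- **Corollary of the Hall–Ore theorem.**
For a relation `r : α → β → Prop` between finite types, with `M` the maximum
size of a matching (a finset `S ⊆ α` with an injective `f : α → β` such that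
`r a (f a)` for all `a ∈ S`), the number of unmatched elements `|α| − M`
equals the maximum over all finsets `X ⊆ α` of `|X| − |Λ(X)|` (in `ℤ`),
where `Λ(X) = {b | ∃ a ∈ X, r a b}`. -/
theorem unmatched_eq_max_deficiency {α β : Type*} [Fintype α] [Fintype β]
    (r : α → β → Prop) (M : ℕ) (N : ℤ)
    (hM : IsGreatest {n : ℕ | ∃ (S : Finset α) (f : α → β),
      Function.Injective f ∧ (∀ a ∈ S, r a (f a)) ∧ S.card = n} M)
    (hN : IsGreatest {z : ℤ | ∃ X : Finset α,
      z = (X.card : ℤ) - (({b : β | ∃ a ∈ X, r a b} : Set β).ncard : ℤ)} N) :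
    (Fintype.card α : ℤ) - (M : ℤ) = N := by
  obtain ⟨⟨S, f, hf, hr, rfl⟩, hmax⟩ := hM
  obtain ⟨⟨X, hX⟩, hub⟩ := hN
  apply le_antisymm
  · have hN0 : 0 ≤ N := hub ⟨∅, by simp⟩
    lift N to ℕ using hN0 with d
    obtain ⟨S', f', hf', hr', hS'⟩ := exists_injOn_rel_of_card_le_add r d f fun Y => by
      have := hub ⟨Y, rfl⟩
      omega
    obtain ⟨g, hg, hgf⟩ :=
      exists_injective_eqOn_of_card_le (Fintype.card_le_of_injective f hf) hf'
    have := hmax ⟨S', g, hg, fun a ha => hgf a ha ▸ hr' a ha, rfl⟩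
    omega
  · have := card_add_card_le_of_matching hf.injOn hr X
    omega
end

section
/- Let G be a simple graph on a finite vertex type V and let C be a finset of vertices such that every vertex of C has a neighbor in G and |N(C)| < |C|, where N(C) = {w | ∃ u ∈ C, G.Adj u w}. Then there exist distinct vertices u, v ∈ C and a vertex w adjacent to both u and v such that in the graph G' obtained from G by adding the undirected edge (u, v) (i.e., G' = G ⊔ edge uv), the vertices u, v, w are pairwise adjacent, forming a closed triplet u ↔ w ↔ v ↔ u (a triangular motif). -/
/-- **Link addition in a contraction creates a closed triplet (Theorem 2).**
If `C` is a finset of vertices of a simple graph `G` on a finite vertex type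
such that every vertex of `C` has a neighbor and `|N(C)| < |C|`, where
`N(C) = {w | ∃ u ∈ C, G.Adj u w}`, then there are distinct `u, v ∈ C` and a
common neighbor `w` of `u` and `v` such that in `G' = G ⊔ edge u v` the
vertices `u, v, w` are pairwise adjacent: a closed triplet `u ↔ w ↔ v ↔ u`. -/
theorem link_addition_creates_triangle {V : Type*} [Fintype V]
    (G : SimpleGraph V) (C : Finset V)
    (hnbr : ∀ u ∈ C, ∃ w, G.Adj u w)
    (hcard : ({w : V | ∃ u ∈ C, G.Adj u w} : Set V).ncard < C.card) :
    ∃ u ∈ C, ∃ v ∈ C, u ≠ v ∧ ∃ w, G.Adj u w ∧ G.Adj v w ∧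
      ((G ⊔ SimpleGraph.edge u v).Adj u v ∧
       (G ⊔ SimpleGraph.edge u v).Adj u w ∧
       (G ⊔ SimpleGraph.edge u v).Adj v w) := by
  choose! f hf using hnbr
  obtain ⟨u, hu, v, hv, huv, h⟩ :=
    Set.exists_ne_map_eq_of_ncard_lt_of_maps_to (s := (C : Set V))
      (t := {w : V | ∃ u ∈ C, G.Adj u w}) (f := f)
      (by rwa [Set.ncard_coe_finset C]) (fun u hu => ⟨u, hu, hf u hu⟩) (Set.toFinite _)
  have huf : G.Adj u (f u) := hf u hu
  have hvf : G.Adj v (f u) := h ▸ hf v hv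
  exact ⟨u, hu, v, hv, huv, f u, huf, hvf,
    Or.inr (by simp [SimpleGraph.edge_adj, huv]), Or.inl huf, Or.inl hvf⟩
end
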